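/- Let K be an algebraically closed field, n ≥ 3, and let G be any permissible simple graph on the vertex set Fin n. Then there exists an n×(n−2) matrix A over K with rank A = n − 2 such that Graph(A) = G; that is, for all distinct i, j in Fin n, i and j are adjacent in G if and only if for every injection f : Fin (n−2) ↪ Fin n with range equal to the complement of {i, j}, det (A.submatrix f id) = 0. -/

import Mathlib

/-- A simple graph on `n` vertices is permissible if it is not complete and
adjacency is transitive among distinct non-dominating vertices (vertices of
degree `≠ n - 1`), i.e. the induced subgraph on the non-dominating vertices is
a disjoint union of cliques. -/
def IsPermissible {n : ℕ} (G : SimpleGraph (Fin n)) : Prop :=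
  G ≠ ⊤ ∧
  ∀ u v w : Fin n, (G.neighborSet u).ncard ≠ n - 1 → (G.neighborSet v).ncard ≠ n - 1 →
    (G.neighborSet w).ncard ≠ n - 1 → u ≠ w → G.Adj u v → G.Adj v w → G.Adj u w

/-- Over an infinite field, a permissible graph is the parallelism graph of vectors `(x i, y i)`
in the plane which are not all parallel. -/
theorem IsPermissible.exists_plane_vectors {K : Type*} [Field K] [Infinite K] {n : ℕ}
    {G : SimpleGraph (Fin n)} (hG : IsPermissible G) :
    ∃ x y : Fin n → K, (∃ i j, x i * y j - x j * y i ≠ 0) ∧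
      ∀ i j, i ≠ j → (G.Adj i j ↔ x i * y j - x j * y i = 0) := by
  classical
  obtain ⟨hne, htrans⟩ := hG
  have hdom : ∀ i, (G.neighborSet i).ncard = n - 1 → ∀ j, i ≠ j → G.Adj i j := by
    intro i hi j hij
    have hsub : G.neighborSet i ⊆ {i}ᶜ := fun k hk => (G.ne_of_adj hk).symm
    have heq := Set.eq_of_subset_of_ncard_le hsub (by
      rw [hi, Set.ncard_compl, Set.ncard_singleton, Nat.card_fin])
    have : j ∈ G.neighborSet i := by rw [heq]; exact hij.symm
    exact this
  let s : Setoid (Fin n) :=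
    { r := fun i j => i = j ∨ ((G.neighborSet i).ncard ≠ n - 1 ∧
        (G.neighborSet j).ncard ≠ n - 1 ∧ G.Adj i j)
      iseqv :=
        { refl := fun i => Or.inl rfl
          symm := by
            rintro i j (h | ⟨hi, hj, h⟩)
            · exact Or.inl h.symm
            · exact Or.inr ⟨hj, hi, h.symm⟩
          trans := by
            rintro i j k (rfl | ⟨hi, hj, h⟩) (rfl | ⟨hj', hk, h'⟩)
            · exact Or.inl rfl
            · exact Or.inr ⟨hj', hk, h'⟩
            · exact Or.inr ⟨hi, hj, h⟩
            · by_cases hik : i = k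
              · exact Or.inl hik
              · exact Or.inr ⟨hi, hk, htrans i j k hi hj hk hik h h'⟩ } }
  let e : Quotient s ↪ K := (Finite.equivFin (Quotient s)).toEmbedding.trans
    (Fin.valEmbedding.trans (Infinite.natEmbedding K))
  let x : Fin n → K := fun i => if (G.neighborSet i).ncard = n - 1 then 0 else 1
  let y : Fin n → K := fun i => if (G.neighborSet i).ncard = n - 1 then 0 else e ⟦i⟧
  have key : ∀ i j, i ≠ j → (G.Adj i j ↔ x i * y j - x j * y i = 0) := by
    intro i j hij
    by_cases hi : (G.neighborSet i).ncard = n - 1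
    · simp [x, y, hi, hdom i hi j hij]
    by_cases hj : (G.neighborSet j).ncard = n - 1
    · simp [x, y, hj, (hdom j hj i hij.symm).symm]
    have hr : (⟦j⟧ : Quotient s) = ⟦i⟧ ↔ G.Adj i j := by
      rw [eq_comm, Quotient.eq]
      change (i = j ∨ _) ↔ _
      simp [hij, hi, hj]
    simp [x, y, hi, hj, sub_eq_zero, e.injective.eq_iff, hr]
  refine ⟨x, y, ?_, key⟩
  by_contra! h
  exact hne (by ext i j; exact ⟨fun hij => hij.ne, fun hij => (key i j hij).2 (h i j)⟩)

/-- If the vectors `(x i, y i)` are not all parallel, some `n × (n - 2)` matrix whose columns span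
the linear relations between them has `{i, j}ᶜ`-minors that vanish exactly when the `i`-th and
`j`-th vectors are parallel. -/
theorem exists_matrix_minor_eq_zero_iff {K : Type*} [Field K] {n : ℕ} (x y : Fin n → K)
    (hxy : ∃ i j, x i * y j - x j * y i ≠ 0) :
    ∃ A : Matrix (Fin n) (Fin (n - 2)) K, A.rank = n - 2 ∧
      ∀ i j, i ≠ j → ∀ f : Fin (n - 2) ↪ Fin n, Set.range f = ({i, j} : Set (Fin n))ᶜ →
        ((A.submatrix f id).det = 0 ↔ x i * y j - x j * y i = 0) := by
  classical
  let L : (Fin n → K) →ₗ[K] K × K :=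
    (Fintype.linearCombination K x).prod (Fintype.linearCombination K y)
  have hL : ∀ u, u ∈ LinearMap.ker L ↔ ∑ i, u i * x i = 0 ∧ ∑ i, u i * y i = 0 := by
    intro u
    simp [L, Fintype.linearCombination_apply]
  have hsurj : Function.Surjective L := by
    obtain ⟨i, j, hd⟩ := hxy
    rintro ⟨a, b⟩
    refine ⟨Pi.single i ((a * y j - b * x j) / (x i * y j - x j * y i)) +
      Pi.single j ((b * x i - a * y i) / (x i * y j - x j * y i)), ?_⟩
    have hdiv : ∀ s t : K, s / (x i * y j - x j * y i) * t = s * t / (x i * y j - x j * y i) :=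
      fun s t => div_mul_eq_mul_div _ _ _
    ext
    all_goals
      simp only [L, map_add, LinearMap.prod_apply, Function.prod_apply, Prod.fst_add, Prod.snd_add,
        Fintype.linearCombination_apply_single, smul_eq_mul, hdiv, ← add_div]
      rw [div_eq_iff hd]
      ring
  have hfin : Module.finrank K (LinearMap.ker L) = n - 2 := by
    have h := L.finrank_range_add_finrank_ker
    rw [LinearMap.range_eq_top.2 hsurj, finrank_top] at h
    simp at h
    omega
  let b := Module.finBasisOfFinrankEq K (LinearMap.ker L) hfin
  let A : Matrix (Fin n) (Fin (n - 2)) K := Matrix.of fun i k => (b k : Fin n → K) i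
  have hA : ∀ v, A.mulVec v = ((b.equivFun.symm v : LinearMap.ker L) : Fin n → K) := by
    intro v
    ext i
    simp [A, Matrix.mulVec, dotProduct, Module.Basis.equivFun_symm_apply, mul_comm]
  refine ⟨A, ?_, ?_⟩
  · have hli : LinearIndependent K A.col :=
      b.linearIndependent.map' (LinearMap.ker L).subtype (Submodule.ker_subtype _)
    rw [← Matrix.rank_transpose, LinearIndependent.rank_matrix (M := A.transpose) hli,
      Fintype.card_fin]
  intro i j hij f hf
  have hcompl : ∀ l, l ≠ i → l ≠ j → ∃ k, f k = l := by
    intro l hli hlj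
    have : l ∈ Set.range f := by rw [hf]; simp [hli, hlj]
    exact this
  have hfk : ∀ k, f k ≠ i ∧ f k ≠ j := by
    intro k
    have : f k ∈ ({i, j} : Set (Fin n))ᶜ := hf ▸ Set.mem_range_self k
    simpa using this
  rw [← Matrix.exists_mulVec_eq_zero_iff]
  constructor
  · rintro ⟨v, hv, hv0⟩
    have hu0 : ∀ l, l ≠ i → l ≠ j → A.mulVec v l = 0 := by
      intro l hli hlj
      obtain ⟨k, rfl⟩ := hcompl l hli hlj
      exact congrFun hv0 k
    have hker : A.mulVec v ∈ LinearMap.ker L := by rw [hA]; exact (b.equivFun.symm v).2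
    have hsum : ∀ z : Fin n → K, ∑ l, A.mulVec v l * z l =
        A.mulVec v i * z i + A.mulVec v j * z j := fun z =>
      Fintype.sum_eq_add i j hij fun l hl => by rw [hu0 l hl.1 hl.2, zero_mul]
    obtain ⟨h1, h2⟩ := (hL _).1 hker
    rw [hsum] at h1 h2
    by_contra hd
    have hi : A.mulVec v i = 0 := by
      have : A.mulVec v i * (x i * y j - x j * y i) = 0 := by
        linear_combination y j * h1 - x j * h2
      exact (mul_eq_zero.1 this).resolve_right hd
    have hj : A.mulVec v j = 0 := by
      have : A.mulVec v j * (x i * y j - x j * y i) = 0 := by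
        linear_combination x i * h2 - y i * h1
      exact (mul_eq_zero.1 this).resolve_right hd
    have hz : A.mulVec v = 0 := by
      ext l
      by_cases hli : l = i
      · rw [hli, hi]; rfl
      by_cases hlj : l = j
      · rw [hlj, hj]; rfl
      exact hu0 l hli hlj
    rw [hA] at hz
    exact hv (b.equivFun.symm.map_eq_zero_iff.1 (Subtype.ext hz))
  · intro hd
    obtain ⟨α, β, hne, h1, h2⟩ : ∃ α β : K, (α ≠ 0 ∨ β ≠ 0) ∧
        α * x i + β * x j = 0 ∧ α * y i + β * y j = 0 := by
      by_cases hx : x i = 0 ∧ x j = 0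
      · by_cases hy : y i = 0 ∧ y j = 0
        · exact ⟨1, 0, by simp, by simp [hx], by simp [hy]⟩
        · exact ⟨y j, -y i, by grind, by simp [hx], by ring⟩
      · exact ⟨x j, -x i, by grind, by ring, by linear_combination -hd⟩
    let u : Fin n → K := Pi.single i α + Pi.single j β
    have hui : u i = α := by simp [u, hij]
    have huj : u j = β := by simp [u, hij.symm]
    have hul : ∀ l, l ≠ i → l ≠ j → u l = 0 := by
      intro l hli hlj
      simp [u, hli, hlj]
    have hsum : ∀ z : Fin n → K, ∑ l, u l * z l = α * z i + β * z j := fun z => by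
      rw [Fintype.sum_eq_add i j hij fun l hl => by rw [hul l hl.1 hl.2, zero_mul], hui, huj]
    have hu : u ∈ LinearMap.ker L := (hL u).2 ⟨by rw [hsum, h1], by rw [hsum, h2]⟩
    have hAu : A.mulVec (b.equivFun ⟨u, hu⟩) = u := by rw [hA, LinearEquiv.symm_apply_apply]
    refine ⟨b.equivFun ⟨u, hu⟩, ?_, ?_⟩
    · intro h0
      rw [h0, Matrix.mulVec_zero] at hAu
      rcases hne with h | h
      · exact h (by rw [← hui, ← hAu]; rfl)
      · exact h (by rw [← huj, ← hAu]; rfl)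
    · ext k
      change A.mulVec (b.equivFun ⟨u, hu⟩) (f k) = 0
      rw [hAu, hul _ (hfk k).1 (hfk k).2]

/-- The complement of a pair in `Fin n` is the range of an embedding of `Fin (n - 2)`. -/
theorem exists_embedding_range_eq_compl_pair {n : ℕ} {i j : Fin n} (hij : i ≠ j) :
    ∃ f : Fin (n - 2) ↪ Fin n, Set.range f = ({i, j} : Set (Fin n))ᶜ := by
  have hc : (({i, j} : Finset (Fin n))ᶜ).card = n - 2 := by
    rw [Finset.card_compl, Finset.card_pair hij, Fintype.card_fin]
  exact ⟨(({i, j} : Finset (Fin n))ᶜ.orderEmbOfFin hc).toEmbedding,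
    (Finset.range_orderEmbOfFin _ hc).trans (by rw [Finset.coe_compl, Finset.coe_pair])⟩

/-- Every permissible graph on `n` vertices is realized as `Graph(A)` for some
`n × (n-2)` matrix `A` of rank `n - 2`: distinct `i, j` are adjacent in `G`
exactly when the `(n-2)`-minor of `A` on the rows complementary to `{i, j}`
vanishes. -/
theorem stmt_15 (K : Type*) [Field K] [IsAlgClosed K] (n : ℕ) (hn : 3 ≤ n)
    (G : SimpleGraph (Fin n)) (hG : IsPermissible G) :
    ∃ A : Matrix (Fin n) (Fin (n - 2)) K, A.rank = n - 2 ∧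
      ∀ i j : Fin n, i ≠ j →
        (G.Adj i j ↔ ∀ f : Fin (n - 2) ↪ Fin n,
          Set.range f = ({i, j} : Set (Fin n))ᶜ → (A.submatrix f id).det = 0) := by
  obtain ⟨x, y, hxy, hadj⟩ := hG.exists_plane_vectors (K := K)
  obtain ⟨A, hrank, hA⟩ := exists_matrix_minor_eq_zero_iff x y hxy
  refine ⟨A, hrank, fun i j hij => ?_⟩
  rw [hadj i j hij]
  refine ⟨fun h f hf => (hA i j hij f hf).2 h, fun h => ?_⟩
  obtain ⟨f, hf⟩ := exists_embedding_range_eq_compl_pair hij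
  exact (hA i j hij f hf).1 (h f hf)
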